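/- As i → +∞, the operators a_i a_i† converge in the strong operator topology to the rank-one orthogonal projection P_Ω onto ℂΩ; that is, for every ξ in the monotone Fock space F, a_i a_i† ξ → ⟨Ω, ξ⟩ Ω as i → +∞. -/

import Mathlib

noncomputable section

open ContinuousLinearMap
open scoped InnerProductSpace ComplexOrder

/-- The discrete monotone Fock space: `ℓ²` over the finite subsets of `ℤ`. -/
abbrev MF : Type := lp (fun _ : Finset ℤ => ℂ) 2

/-- The canonical orthonormal basis vector corresponding to a finite subset `S ⊆ ℤ`;
`eS ∅` is the vacuum vector `Ω`. -/
noncomputable def eS (S : Finset ℤ) : MF := lp.single 2 S 1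

/-- `a : ℤ → MF →L[ℂ] MF` is the family of monotone annihilation operators:
`a i (eS S) = eS (S \ {i})` if `S` is nonempty with `min S = i`, and `a i (eS S) = 0`
otherwise.  The creation operator `a_i†` is the Hilbert-space adjoint of `a i`. -/
def IsMonotoneAnnihilation (a : ℤ → MF →L[ℂ] MF) : Prop :=
  ∀ (i : ℤ) (S : Finset ℤ),
    (S.min = (i : WithBot ℤ) → a i (eS S) = eS (S.erase i)) ∧
    (S.min ≠ (i : WithBot ℤ) → a i (eS S) = 0)

/-- The monotone C*-algebra `𝔐`: the unital C*-subalgebra of `B(F)` generated by the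
annihilation operators. -/
noncomputable def MonM (a : ℤ → MF →L[ℂ] MF) : StarSubalgebra ℂ (MF →L[ℂ] MF) :=
  (StarAlgebra.adjoin ℂ (Set.range a)).topologicalClosure

lemma a_mem_MonM (a : ℤ → MF →L[ℂ] MF) (i : ℤ) : a i ∈ MonM a :=
  StarSubalgebra.le_topologicalClosure _ (StarAlgebra.subset_adjoin ℂ _ ⟨i, rfl⟩)

lemma aad_mem_MonM (a : ℤ → MF →L[ℂ] MF) (i : ℤ) :
    (a i).comp (adjoint (a i)) ∈ MonM a := by
  have h := mul_mem (a_mem_MonM a i) (star_mem (a_mem_MonM a i))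
  rwa [star_eq_adjoint, mul_def] at h

lemma ada_mem_MonM (a : ℤ → MF →L[ℂ] MF) (i : ℤ) :
    (adjoint (a i)).comp (a i) ∈ MonM a := by
  have h := mul_mem (star_mem (a_mem_MonM a i)) (a_mem_MonM a i)
  rwa [star_eq_adjoint, mul_def] at h

lemma Finset.min_eq_coe_iff {α : Type*} [LinearOrder α] {S : Finset α} {i : α} :
    S.min = (i : WithTop α) ↔ i ∈ S ∧ ∀ j ∈ S, i ≤ j := by
  refine ⟨fun h => ⟨Finset.mem_of_min h, fun j hj => Finset.min_le_of_eq hj h⟩, fun ⟨hi, h⟩ => ?_⟩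
  exact le_antisymm (Finset.min_le hi) (Finset.le_min fun j hj => WithTop.coe_le_coe.2 (h j hj))

lemma Finset.min_eq_coe_and_erase_eq_iff {α : Type*} [LinearOrder α] {S T : Finset α} {i : α} :
    (S.min = (i : WithTop α) ∧ S.erase i = T) ↔ (∀ j ∈ T, i < j) ∧ insert i T = S := by
  rw [Finset.min_eq_coe_iff]
  constructor
  · rintro ⟨⟨hi, h⟩, rfl⟩
    refine ⟨fun j hj => ?_, Finset.insert_erase hi⟩
    rw [Finset.mem_erase] at hj
    exact lt_of_le_of_ne (h j hj.2) hj.1.symm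
  · rintro ⟨h, rfl⟩
    refine ⟨⟨Finset.mem_insert_self i T, fun j hj => ?_⟩,
      Finset.erase_insert fun hi => lt_irrefl i (h i hi)⟩
    rcases Finset.mem_insert.1 hj with rfl | hj
    · exact le_rfl
    · exact (h j hj).le

lemma eS_apply (S T : Finset ℤ) : eS S T = if S = T then 1 else 0 := by
  simp [eS, lp.single_apply, Pi.single_apply, eq_comm]

lemma inner_eS_left (S : Finset ℤ) (ξ : MF) : ⟪eS S, ξ⟫_ℂ = ξ S := by
  simp [eS, lp.inner_single_left]

namespace IsMonotoneAnnihilation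

variable {a : ℤ → MF →L[ℂ] MF}

lemma apply_eS (ha : IsMonotoneAnnihilation a) (i : ℤ) (S : Finset ℤ) :
    a i (eS S) = if S.min = (i : WithTop ℤ) then eS (S.erase i) else 0 := by
  split_ifs with h
  · exact (ha i S).1 h
  · exact (ha i S).2 h

lemma adjoint_apply_eS (ha : IsMonotoneAnnihilation a) (i : ℤ) (T : Finset ℤ) :
    adjoint (a i) (eS T) = if ∀ j ∈ T, i < j then eS (insert i T) else 0 := by
  ext S
  have key := @Finset.min_eq_coe_and_erase_eq_iff ℤ _ S T i
  rw [← inner_eS_left, adjoint_inner_right, ha.apply_eS]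
  split_ifs with h₁ h₂ h₂
  · rw [inner_eS_left, eS_apply, eS_apply]
    simp_all [eq_comm]
  · rw [inner_eS_left, eS_apply, lp.coeFn_zero, Pi.zero_apply, if_neg]
    exact fun h => h₂ (key.1 ⟨h₁, h.symm⟩).1
  · rw [inner_zero_left, eS_apply, if_neg]
    exact fun h => h₁ (key.2 ⟨h₂, h⟩).1
  · rw [inner_zero_left, lp.coeFn_zero, Pi.zero_apply]

lemma comp_adjoint_apply_eS (ha : IsMonotoneAnnihilation a) (i : ℤ) (T : Finset ℤ) :
    a i (adjoint (a i) (eS T)) = if ∀ j ∈ T, i < j then eS T else 0 := by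
  rw [ha.adjoint_apply_eS]
  split_ifs with h
  · have := Finset.min_eq_coe_and_erase_eq_iff.2 ⟨h, rfl⟩
    rw [ha.apply_eS, if_pos this.1, this.2]
  · exact map_zero _

lemma comp_adjoint_apply (ha : IsMonotoneAnnihilation a) (i : ℤ) (ξ : MF) (T : Finset ℤ) :
    a i (adjoint (a i) ξ) T = if ∀ j ∈ T, i < j then ξ T else 0 := by
  rw [← inner_eS_left, ← adjoint_inner_left, adjoint_inner_right, ha.comp_adjoint_apply_eS]
  split_ifs
  · exact inner_eS_left T ξ
  · exact inner_zero_left ξ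

end IsMonotoneAnnihilation

/-- As `i → +∞`, `a_i a_i†` converges strongly to the rank-one projection onto `ℂΩ`. -/
theorem stmt8 (a : ℤ → MF →L[ℂ] MF) (ha : IsMonotoneAnnihilation a) (ξ : MF) :
    Filter.Tendsto (fun i : ℤ => a i (adjoint (a i) ξ)) Filter.atTop
      (nhds ((⟪eS ∅, ξ⟫_ℂ) • eS ∅)) := by
  rw [tendsto_iff_norm_sub_tendsto_zero]
  have norm_sq (η : MF) : ‖η‖ ^ 2 = ∑' T, ‖η T‖ ^ 2 := by
    simpa using lp.norm_rpow_eq_tsum (p := 2) (by simp) η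
  have summable_sq : Summable fun T => ‖ξ T‖ ^ 2 := by
    simpa using (lp.memℓp ξ).summable (by simp)
  have coord (i : ℤ) (T : Finset ℤ) :
      (a i (adjoint (a i) ξ) - ⟪eS ∅, ξ⟫_ℂ • eS ∅ : MF) T =
        if T.Nonempty ∧ ∀ j ∈ T, i < j then ξ T else 0 := by
    rw [lp.coeFn_sub, Pi.sub_apply, ha.comp_adjoint_apply, lp.coeFn_smul, Pi.smul_apply,
      eS_apply, inner_eS_left]
    rcases T.eq_empty_or_nonempty with rfl | hT
    · simp
    · simp [hT, hT.ne_empty.symm]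
  have tendsto_sq : Filter.Tendsto
      (fun i : ℤ => ‖a i (adjoint (a i) ξ) - ⟪eS ∅, ξ⟫_ℂ • eS ∅‖ ^ 2) Filter.atTop (nhds 0) := by
    simp only [norm_sq, coord]
    rw [← tsum_zero (α := ℝ) (β := Finset ℤ)]
    refine tendsto_tsum_of_dominated_convergence summable_sq (fun T => ?_)
      (Filter.Eventually.of_forall fun i T => ?_)
    · refine tendsto_const_nhds.congr' ?_
      rcases T.eq_empty_or_nonempty with rfl | ⟨j, hj⟩
      · simp
      · filter_upwards [Filter.eventually_ge_atTop j] with i hij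
        rw [if_neg fun h => (h.2 j hj).not_ge hij]
        simp
    · split_ifs <;> simp
  simpa using tendsto_sq.sqrt
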